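/- Let n ≥ 1, let α = (α₁,…,αₙ) ∈ (0,π)ⁿ be a vector of non-exceptional angles, let ℓ ∈ (0,∞)ⁿ and σ ∈ ℝ. Then T(α,ℓ,σ) equals the 2×2 identity matrix if and only if F_even(α,ℓ,σ) = ∏_{j=1}^n sin(π²/(2α_j)) and F_odd(α,ℓ,σ) = 0. Consequently, if F^P(α,ℓ,σ) = 0 (i.e. σ is a quasi-eigenvalue), then the eigenvalue 1 of T(α,ℓ,σ) has geometric multiplicity two if and only if F_odd(α,ℓ,σ) = 0; otherwise its geometric multiplicity is one. (This is Theorem 2.16(a): a positive root of F^P is a quasi-eigenvalue of multiplicity two if and only if it is additionally a root of F_odd.) -/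

import Mathlib

open Matrix

/-- The vertex transfer matrix `A(α)` (for non-exceptional `α`). -/
noncomputable def Amat (α : ℝ) : Matrix (Fin 2) (Fin 2) ℂ :=
  !![((Real.sin (Real.pi ^ 2 / (2 * α)))⁻¹ : ℂ),
      -Complex.I * ((Real.cos (Real.pi ^ 2 / (2 * α)) / Real.sin (Real.pi ^ 2 / (2 * α)) : ℝ) : ℂ);
      Complex.I * ((Real.cos (Real.pi ^ 2 / (2 * α)) / Real.sin (Real.pi ^ 2 / (2 * α)) : ℝ) : ℂ),
      ((Real.sin (Real.pi ^ 2 / (2 * α)))⁻¹ : ℂ)]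

/-- The side transfer matrix `B(ℓ,σ) = diag(exp(iℓσ), exp(-iℓσ))`. -/
noncomputable def Bmat (ℓ σ : ℝ) : Matrix (Fin 2) (Fin 2) ℂ :=
  !![Complex.exp (Complex.I * ((ℓ * σ : ℝ) : ℂ)), 0;
      0, Complex.exp (-(Complex.I * ((ℓ * σ : ℝ) : ℂ)))]

/-- `C(α,ℓ,σ) = A(α) · B(ℓ,σ)`. -/
noncomputable def Cmat (α ℓ σ : ℝ) : Matrix (Fin 2) (Fin 2) ℂ := Amat α * Bmat ℓ σ

/-- The transfer matrix `T(α,ℓ,σ) = C(αₙ,ℓₙ,σ) ⋯ C(α₁,ℓ₁,σ)`. -/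
noncomputable def Tmat {n : ℕ} (α ℓ : Fin n → ℝ) (σ : ℝ) : Matrix (Fin 2) (Fin 2) ℂ :=
  ((List.ofFn fun j => Cmat (α j) (ℓ j) σ).reverse).prod

/-- An angle is exceptional if it is of the form `π/(2k)` for a positive integer `k`. -/
def Exceptional (α : ℝ) : Prop := ∃ k : ℕ, 0 < k ∧ α = Real.pi / (2 * (k : ℝ))

/-- Cyclic successor on `Fin n`. -/
def cyc {n : ℕ} (j : Fin n) : Fin n :=
  ⟨(j.val + 1) % n, Nat.mod_lt _ (Nat.lt_of_le_of_lt (Nat.zero_le _) j.isLt)⟩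

/-- The sign vector `ζ ∈ {±1}ⁿ` encoded by `ε : Fin n → Bool`. -/
def sgnB {n : ℕ} (ε : Fin n → Bool) (j : Fin n) : ℝ := if ε j then 1 else -1

/-- Sign vectors `ζ ∈ {±1}ⁿ` with `ζ₁ = 1`. -/
def zSet (n : ℕ) : Finset (Fin n → Bool) :=
  Finset.univ.filter fun ε => ∀ j : Fin n, (j : ℕ) = 0 → ε j = true

/-- The dot product `ℓ · ζ`. -/
noncomputable def dotSgn {n : ℕ} (ℓ : Fin n → ℝ) (ε : Fin n → Bool) : ℝ :=
  ∑ j, ℓ j * sgnB ε j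

/-- `𝔭_ζ(α) = ∏_{j ∈ Ch(ζ)} cos(π²/(2α_j))`, where `Ch(ζ)` is the set of indices of sign change
of `ζ`, with the cyclic convention `ζ_{n+1} = ζ₁`. -/
noncomputable def pCoef {n : ℕ} (α : Fin n → ℝ) (ε : Fin n → Bool) : ℝ :=
  ∏ j ∈ Finset.univ.filter (fun j : Fin n => ε j ≠ ε (cyc j)),
    Real.cos (Real.pi ^ 2 / (2 * α j))

/-- `F_even(α,ℓ,σ) = Σ_{ζ ∈ {±1}ⁿ, ζ₁ = 1} 𝔭_ζ(α) cos((ℓ·ζ)σ)`. -/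
noncomputable def Feven {n : ℕ} (α ℓ : Fin n → ℝ) (σ : ℝ) : ℝ :=
  ∑ ε ∈ zSet n, pCoef α ε * Real.cos (dotSgn ℓ ε * σ)

/-- `F_odd(α,ℓ,σ) = Σ_{ζ ∈ {±1}ⁿ, ζ₁ = 1} 𝔭_ζ(α) sin((ℓ·ζ)σ)`. -/
noncomputable def Fodd {n : ℕ} (α ℓ : Fin n → ℝ) (σ : ℝ) : ℝ :=
  ∑ ε ∈ zSet n, pCoef α ε * Real.sin (dotSgn ℓ ε * σ)

/-- The monoid `SU(1,1)` of matrices `!![a, b; conj b, conj a]` of determinant one. -/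
def suOneOne : Submonoid (Matrix (Fin 2) (Fin 2) ℂ) where
  carrier := {M | M 1 1 = star (M 0 0) ∧ M 1 0 = star (M 0 1) ∧ M.det = 1}
  one_mem' := by simp
  mul_mem' := by
    rintro M N ⟨h₁, h₂, h₃⟩ ⟨k₁, k₂, k₃⟩
    refine ⟨?_, ?_, by rw [Matrix.det_mul, h₃, k₃, one_mul]⟩
    · simp only [Matrix.mul_apply, Fin.sum_univ_two, h₁, h₂, k₁, k₂, star_add, star_mul', star_star]
      ring
    · simp only [Matrix.mul_apply, Fin.sum_univ_two, h₁, h₂, k₁, k₂, star_add, star_mul', star_star]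
      ring

lemma eq_one_iff_of_mem_suOneOne {M : Matrix (Fin 2) (Fin 2) ℂ} (hM : M ∈ suOneOne) :
    M = 1 ↔ M 0 0 = 1 := by
  obtain ⟨h₁, h₂, h₃⟩ := hM
  refine ⟨fun h => by simp [h], fun h => ?_⟩
  have hb : M 0 1 = 0 := by
    rw [Matrix.det_fin_two, h₁, h₂, h] at h₃
    simpa using h₃
  ext i j
  fin_cases i <;> fin_cases j <;> simp [h, h₁, h₂, hb]

lemma det_sub_one_of_mem_suOneOne {M : Matrix (Fin 2) (Fin 2) ℂ} (hM : M ∈ suOneOne)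
    (hre : (M 0 0).re = 1) : (M - 1).det = 0 := by
  obtain ⟨h₁, -, h₃⟩ := hM
  have htr : M 0 0 + M 1 1 = 2 := by
    rw [h₁]
    apply Complex.ext <;> simp [hre]; norm_num
  rw [Matrix.det_fin_two] at h₃ ⊢
  simp
  linear_combination h₃ - htr

lemma finrank_ker_mulVecLin_eq_two_iff (N : Matrix (Fin 2) (Fin 2) ℂ) :
    Module.finrank ℂ (LinearMap.ker N.mulVecLin) = 2 ↔ N = 0 := by
  have h2 : Module.finrank ℂ (Fin 2 → ℂ) = 2 := by simp
  refine ⟨fun h => ?_, fun h => ?_⟩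
  · have htop := Submodule.eq_top_of_finrank_eq (h.trans h2.symm)
    rw [LinearMap.ker_eq_top, ← Matrix.toLin'_apply'] at htop
    exact Matrix.toLin'.map_eq_zero_iff.mp htop
  · rw [h, Matrix.mulVecLin_zero, LinearMap.ker_zero, finrank_top, h2]

lemma finrank_ker_mulVecLin_eq_one {N : Matrix (Fin 2) (Fin 2) ℂ} (hN : N ≠ 0)
    (hdet : N.det = 0) : Module.finrank ℂ (LinearMap.ker N.mulVecLin) = 1 := by
  have hle : Module.finrank ℂ (LinearMap.ker N.mulVecLin) ≤ 2 := by
    simpa using (LinearMap.ker N.mulVecLin).finrank_le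
  have h2 := mt (finrank_ker_mulVecLin_eq_two_iff N).mp hN
  have h0 : Module.finrank ℂ (LinearMap.ker N.mulVecLin) ≠ 0 := by
    rw [Ne, Submodule.finrank_eq_zero, Submodule.eq_bot_iff]
    obtain ⟨v, hv, hNv⟩ := Matrix.exists_mulVec_eq_zero_iff.mpr hdet
    exact fun h => hv (h v (by simpa using hNv))
  omega

/-- Expansion of an entry of a matrix product as a sum over paths. -/
lemma prod_reverse_ofFn_apply {ι κ R : Type*} [Fintype ι] [DecidableEq ι] [Fintype κ]
    [DecidableEq κ] [CommRing R] (f : κ ≃ ι) (t : κ) {n : ℕ} (M : Fin n → Matrix ι ι R) (s : κ) :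
    (List.ofFn M).reverse.prod (f t) (f s) =
      ∑ ε : Fin n → κ, if (Fin.snoc ε t : Fin (n + 1) → κ) 0 = s then
        ∏ j : Fin n, M j (f ((Fin.snoc ε t : Fin (n + 1) → κ) j.succ))
          (f ((Fin.snoc ε t : Fin (n + 1) → κ) j.castSucc)) else 0 := by
  induction n generalizing s with
  | zero => simp [Matrix.one_apply, Fin.snoc]
  | succ n ih =>
    have hsnoc (u : κ) (ε : Fin n → κ) :
        (Fin.snoc ((Fin.consEquiv fun _ => κ) (u, ε)) t : Fin (n + 2) → κ) =
          Fin.cons u (Fin.snoc ε t : Fin (n + 1) → κ) :=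
      (Fin.cons_snoc_eq_snoc_cons u ε t).symm
    rw [List.ofFn_succ, List.reverse_cons, List.prod_append, List.prod_singleton,
      Matrix.mul_apply, ← f.sum_comp, ← (Fin.consEquiv fun _ => κ).sum_comp,
      Fintype.sum_prod_type, Finset.sum_eq_single (f := fun u => ∑ ε : Fin n → κ, _) s]
    · simp only [ih, Finset.sum_mul]
      rw [Finset.sum_comm]
      refine Finset.sum_congr rfl fun ε _ => ?_
      simp only [hsnoc, Fin.prod_univ_succ,
        Fin.cons_zero, Fin.cons_succ, Fin.castSucc_zero, ← Fin.succ_castSucc, ite_mul, zero_mul,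
        Finset.sum_ite_eq, Finset.mem_univ, if_true]
      ring
    · intro u _ hu
      refine Finset.sum_eq_zero fun ε _ => ?_
      simp [hu]
    · simp

lemma snoc_succ_eq_cyc {n : ℕ} (ε : Fin (n + 1) → Bool) {t : Bool} (h : ε 0 = t)
    (j : Fin (n + 1)) : (Fin.snoc ε t : Fin (n + 2) → Bool) j.succ = ε (cyc j) := by
  induction j using Fin.lastCases with
  | last => simp [cyc, ← h, Fin.succ_last]
  | cast j =>
    rw [Fin.succ_castSucc, Fin.snoc_castSucc]
    congr 1
    ext
    simp [cyc, Nat.mod_eq_of_lt]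

lemma cyc_bijective {n : ℕ} : Function.Bijective (cyc : Fin (n + 1) → Fin (n + 1)) := by
  convert (finRotate (n + 1)).bijective using 1
  ext j
  simp [cyc, Fin.val_add]

lemma sin_ne_zero_of_not_exceptional {α : ℝ} (h₀ : 0 < α) (h : ¬ Exceptional α) :
    Real.sin (Real.pi ^ 2 / (2 * α)) ≠ 0 := by
  intro hs
  obtain ⟨k, hk⟩ := Real.sin_eq_zero_iff.mp hs
  have hπ := Real.pi_pos
  have hkpos : 0 < k := by
    have : 0 < (k : ℝ) * Real.pi := hk ▸ by positivity
    exact_mod_cast pos_of_mul_pos_left this hπ.le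
  lift k to ℕ using hkpos.le
  have hkpos' : (0 : ℝ) < k := by exact_mod_cast hkpos
  refine h ⟨k, by exact_mod_cast hkpos, ?_⟩
  rw [eq_div_iff (by positivity)] at hk ⊢
  push_cast at hk
  apply mul_right_cancel₀ hπ.ne'
  linear_combination hk

lemma Cmat_mem_suOneOne {α : ℝ} (h : Real.sin (Real.pi ^ 2 / (2 * α)) ≠ 0) (ℓ σ : ℝ) :
    Cmat α ℓ σ ∈ suOneOne := by
  have hconj : (starRingEnd ℂ) (Complex.exp (Complex.I * ((ℓ * σ : ℝ) : ℂ))) =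
      Complex.exp (-(Complex.I * ((ℓ * σ : ℝ) : ℂ))) := by
    rw [← Complex.exp_conj]
    simp
  have hconj' : (starRingEnd ℂ) (Complex.exp (-(Complex.I * ((ℓ * σ : ℝ) : ℂ)))) =
      Complex.exp (Complex.I * ((ℓ * σ : ℝ) : ℂ)) := by
    rw [← hconj, Complex.conj_conj]
  refine ⟨?_, ?_, ?_⟩
  · simp [-Complex.ofReal_mul, -Complex.ofReal_sin, Cmat, Amat, Bmat, hconj]
  · simp [-Complex.ofReal_mul, -Complex.ofReal_sin, -Complex.ofReal_cos, Cmat, Amat, Bmat, hconj']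
  · have hA : (Amat α).det = 1 := by
      have h' : ((Real.sin (Real.pi ^ 2 / (2 * α)) : ℝ) : ℂ) ≠ 0 := by exact_mod_cast h
      have hsc : ((Real.sin (Real.pi ^ 2 / (2 * α)) : ℝ) : ℂ) ^ 2 +
          ((Real.cos (Real.pi ^ 2 / (2 * α)) : ℝ) : ℂ) ^ 2 = 1 := by
        exact_mod_cast Real.sin_sq_add_cos_sq _
      rw [Amat, Matrix.det_fin_two_of, Complex.ofReal_div]
      field_simp
      linear_combination -hsc + (Real.cos (Real.pi ^ 2 / (2 * α)) : ℂ) ^ 2 * Complex.I_sq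
    have hB : (Bmat ℓ σ).det = 1 := by
      rw [Bmat, Matrix.det_fin_two_of, ← Complex.exp_add]
      simp
    rw [Cmat, Matrix.det_mul, hA, hB, one_mul]

/-- The matrix `C(α,ℓ,σ)` is diagonally conjugate to a matrix with transition weights
`cos(π²/(2α))` and `1`. -/
lemma Cmat_apply (α ℓ σ : ℝ) (u v : Bool) :
    Cmat α ℓ σ (if u then 0 else 1) (if v then 0 else 1) =
      ((Real.sin (Real.pi ^ 2 / (2 * α)) : ℝ) : ℂ)⁻¹ *
      ((if u then 1 else Complex.I) * (if v then 1 else Complex.I)⁻¹) *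
      ((if v ≠ u then Real.cos (Real.pi ^ 2 / (2 * α)) else 1 : ℝ) : ℂ) *
      Complex.exp (((ℓ * (if v then 1 else -1) * σ : ℝ) : ℂ) * Complex.I) := by
  cases u <;> cases v <;>
    simp [Cmat, Amat, Bmat, mul_comm, mul_left_comm, div_eq_mul_inv]

lemma Tmat_zero_zero {n : ℕ} (hn : 1 ≤ n) (α ℓ : Fin n → ℝ) (σ : ℝ) :
    Tmat α ℓ σ 0 0 = ((∏ j, Real.sin (Real.pi ^ 2 / (2 * α j)) : ℝ) : ℂ)⁻¹ *
      (Feven α ℓ σ + Fodd α ℓ σ * Complex.I) := by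
  obtain ⟨n, rfl⟩ := Nat.exists_eq_succ_of_ne_zero (Nat.one_le_iff_ne_zero.mp hn)
  let f : Bool ≃ Fin 2 :=
    ⟨fun b => if b then 0 else 1, fun i => i = 0, by decide, by decide⟩
  have key := prod_reverse_ofFn_apply f true (fun j => Cmat (α j) (ℓ j) σ) true
  have hF : (Feven α ℓ σ + Fodd α ℓ σ * Complex.I : ℂ) =
      ∑ ε ∈ zSet (n + 1), (pCoef α ε : ℂ) *
        Complex.exp (((dotSgn ℓ ε * σ : ℝ) : ℂ) * Complex.I) := by
    simp only [Feven, Fodd, Complex.ofReal_sum, Finset.sum_mul, ← Finset.sum_add_distrib,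
      Complex.exp_mul_I, Complex.ofReal_mul (pCoef _ _), Complex.ofReal_cos, Complex.ofReal_sin]
    exact Finset.sum_congr rfl fun ε _ => by ring
  have hz : zSet (n + 1) =
      Finset.univ.filter fun ε => (Fin.snoc ε true : Fin (n + 2) → Bool) 0 = true := by
    ext ε
    simp only [zSet, Finset.mem_filter, Finset.mem_univ, true_and, ← Fin.castSucc_zero,
      Fin.snoc_castSucc]
    exact ⟨fun h => h 0 rfl, fun h j hj => by rwa [show j = 0 from Fin.ext hj]⟩
  rw [hF, hz, Finset.sum_filter, Finset.mul_sum]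
  refine key.trans (Finset.sum_congr rfl fun ε _ => ?_)
  split_ifs with h0
  swap
  · simp
  rw [← Fin.castSucc_zero, Fin.snoc_castSucc] at h0
  simp only [snoc_succ_eq_cyc ε h0, Fin.snoc_castSucc]
  have hg : ∏ j, ((if ε (cyc j) then 1 else Complex.I) * (if ε j then 1 else Complex.I)⁻¹) = 1 := by
    rw [Finset.prod_mul_distrib,
      cyc_bijective.prod_comp (fun j => if ε j then 1 else Complex.I), ← Finset.prod_mul_distrib]
    refine Finset.prod_eq_one fun j _ => mul_inv_cancel₀ ?_
    split_ifs <;> simp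
  have he : ∏ j, Complex.exp (((ℓ j * (if ε j then 1 else -1) * σ : ℝ) : ℂ) * Complex.I) =
      Complex.exp (((dotSgn ℓ ε * σ : ℝ) : ℂ) * Complex.I) := by
    rw [← Complex.exp_sum, ← Finset.sum_mul, ← Complex.ofReal_sum, ← Finset.sum_mul]
    rfl
  refine (Finset.prod_congr rfl fun j _ => Cmat_apply (α j) (ℓ j) σ _ _).trans ?_
  rw [Finset.prod_mul_distrib, Finset.prod_mul_distrib, Finset.prod_mul_distrib, hg, he,
    ← Complex.ofReal_prod, ← Finset.prod_filter, Finset.prod_inv_distrib, ← Complex.ofReal_prod,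
    mul_one, mul_assoc]
  rfl

/-- **Theorem 2.16(a).** For a non-exceptional curvilinear polygon, `T(α,ℓ,σ) = Id` iff
`F_even(α,ℓ,σ) = ∏ sin(π²/(2α_j))` and `F_odd(α,ℓ,σ) = 0`; consequently, if `F^P(α,ℓ,σ) = 0`
then the geometric multiplicity of the eigenvalue `1` of `T(α,ℓ,σ)` is two iff
`F_odd(α,ℓ,σ) = 0`, and is one otherwise. -/
theorem stmt4 (n : ℕ) (hn : 1 ≤ n) (α ℓ : Fin n → ℝ)
    (hα : ∀ j, α j ∈ Set.Ioo 0 Real.pi ∧ ¬ Exceptional (α j))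
    (hℓ : ∀ j, 0 < ℓ j) (σ : ℝ) :
    (Tmat α ℓ σ = 1 ↔
      (Feven α ℓ σ = ∏ j, Real.sin (Real.pi ^ 2 / (2 * α j)) ∧ Fodd α ℓ σ = 0)) ∧
    (Feven α ℓ σ - ∏ j, Real.sin (Real.pi ^ 2 / (2 * α j)) = 0 →
      ((Module.finrank ℂ (LinearMap.ker (Tmat α ℓ σ - 1).mulVecLin) = 2 ↔
          Fodd α ℓ σ = 0) ∧
        (Fodd α ℓ σ ≠ 0 →
          Module.finrank ℂ (LinearMap.ker (Tmat α ℓ σ - 1).mulVecLin) = 1))) := by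
  have hsin : ∀ j, Real.sin (Real.pi ^ 2 / (2 * α j)) ≠ 0 := fun j =>
    sin_ne_zero_of_not_exceptional (hα j).1.1 (hα j).2
  have hmem : Tmat α ℓ σ ∈ suOneOne := by
    refine Submonoid.list_prod_mem _ fun M hM => ?_
    rw [List.mem_reverse, List.mem_ofFn] at hM
    obtain ⟨j, rfl⟩ := hM
    exact Cmat_mem_suOneOne (hsin j) _ _
  have hS : (∏ j, Real.sin (Real.pi ^ 2 / (2 * α j))) ≠ 0 :=
    Finset.prod_ne_zero_iff.mpr fun j _ => hsin j
  have h00 := Tmat_zero_zero hn α ℓ σ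
  set S := ∏ j, Real.sin (Real.pi ^ 2 / (2 * α j))
  have hSC : (S : ℂ) ≠ 0 := by exact_mod_cast hS
  have hone : Tmat α ℓ σ = 1 ↔ Feven α ℓ σ = S ∧ Fodd α ℓ σ = 0 := by
    rw [eq_one_iff_of_mem_suOneOne hmem, h00, inv_mul_eq_one₀ hSC, Complex.ext_iff]
    simp [eq_comm]
  refine ⟨hone, fun hP => ?_⟩
  have hE : Feven α ℓ σ = S := sub_eq_zero.mp hP
  have hodd : Tmat α ℓ σ - 1 = 0 ↔ Fodd α ℓ σ = 0 := by
    rw [sub_eq_zero, hone, and_iff_right hE]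
  refine ⟨(finrank_ker_mulVecLin_eq_two_iff _).trans hodd, fun hne =>
    finrank_ker_mulVecLin_eq_one (mt hodd.mp hne) (det_sub_one_of_mem_suOneOne hmem ?_)⟩
  rw [h00, hE, ← Complex.ofReal_inv, Complex.re_ofReal_mul]
  simp [hS]
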